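/- (Lemma 4.) There exists an absolute constant c > 0 such that the following holds. Let A ∈ ℝ^{n×p} have rows a₁, …, aₙ that are i.i.d. N(0, I_p) random vectors. For any fixed x₁, x₂ ∈ ℝ^p, any ν > 0, and any ε ∈ (0,1), with probability at least 1 − 2 e^{−c n ε²}, one has |⟨(I_p − (ν/n) AᵀA) x₁, x₂⟩| ≤ μ₁ ‖x₁‖₂ ‖x₂‖₂, where μ₁ := max{1 − ν(1−ε), ν(1+ε) − 1}. -/

import Mathlib

open MeasureTheory ProbabilityTheory

/-- The Euclidean (ℓ₂) norm of a vector in `ℝ^m`. -/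
noncomputable def l2norm {m : ℕ} (v : Fin m → ℝ) : ℝ := Real.sqrt (∑ i, (v i) ^ 2)

/-- The Euclidean inner product on `ℝ^m`. -/
def dotp {m : ℕ} (v w : Fin m → ℝ) : ℝ := ∑ i, v i * w i

lemma aux_exp (y : ℝ) (hy : |y| ≤ 1 / 2) : 1 ≤ (1 - y) * Real.exp (y + y ^ 2) := by
  obtain ⟨h1, h2⟩ := abs_le.1 hy
  rcases le_total y 0 with h | h
  · have := Real.add_one_le_exp (y + y ^ 2)
    have h3 : (1 - y) * (y + y ^ 2 + 1) ≤ (1 - y) * Real.exp (y + y ^ 2) :=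
      mul_le_mul_of_nonneg_left this (by linarith)
    nlinarith [mul_nonneg (neg_nonneg.2 h) (sq_nonneg y)]
  · have := Real.quadratic_le_exp_of_nonneg (x := y + y ^ 2) (by positivity)
    have h3 := mul_le_mul_of_nonneg_left this (by linarith : 0 ≤ 1 - y)
    refine le_trans ?_ h3
    have h4 : 0 ≤ (1 - y) * (1 + y) ^ 2 - 2 * y := by nlinarith [mul_nonneg h h]
    nlinarith [mul_nonneg (sq_nonneg y) h4]

lemma gauss_sq_aux (l : ℝ) (hl : |l| ≤ 1 / 4) :
    Integrable (fun x : ℝ => Real.exp (l * x ^ 2)) (gaussianReal 0 1) ∧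
    ∫ x, Real.exp (l * x ^ 2) ∂(gaussianReal 0 1) ≤ Real.exp (l + 2 * l ^ 2) := by
  obtain ⟨h1, h2⟩ := abs_le.1 hl
  have hb : 0 < 1 / 2 - l := by linarith
  have key : ∀ x : ℝ, gaussianPDFReal 0 1 x * Real.exp (l * x ^ 2) =
      (√(2 * Real.pi))⁻¹ * Real.exp (-(1 / 2 - l) * x ^ 2) := by
    intro x
    rw [gaussianPDFReal, mul_assoc, ← Real.exp_add]
    simp only [NNReal.coe_one, mul_one, sub_zero]
    congr 2
    ring
  constructor
  · rw [gaussianReal_of_var_ne_zero _ one_ne_zero,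
      integrable_withDensity_iff (measurable_gaussianPDF 0 1)
        (ae_of_all _ fun x => gaussianPDF_lt_top)]
    have : (fun x : ℝ => Real.exp (l * x ^ 2) * (gaussianPDF 0 1 x).toReal) =
        fun x => (√(2 * Real.pi))⁻¹ * Real.exp (-(1 / 2 - l) * x ^ 2) := by
      funext x
      rw [toReal_gaussianPDF, mul_comm, key]
    rw [this]
    exact (integrable_exp_neg_mul_sq hb).const_mul _
  · rw [integral_gaussianReal_eq_integral_smul one_ne_zero]
    simp only [smul_eq_mul, key]
    rw [integral_const_mul, integral_gaussian, ← Real.sqrt_inv, ← Real.sqrt_mul (by positivity)]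
    have e : (2 * Real.pi)⁻¹ * (Real.pi / (1 / 2 - l)) = (1 - 2 * l)⁻¹ := by
      have := Real.pi_pos
      have : 1 - 2 * l ≠ 0 := by linarith
      have : 1 / 2 - l ≠ 0 := by linarith
      field_simp
    rw [e]
    apply Real.sqrt_le_iff.2 ⟨by positivity, ?_⟩
    rw [← Real.exp_nat_mul, inv_le_iff_one_le_mul₀' (by linarith)]
    convert aux_exp (2 * l) (by rw [abs_le]; constructor <;> linarith) using 2
    congr 1
    push_cast; ring

lemma dotp_law {p : ℕ} (w : Fin p → ℝ) :
    (Measure.pi fun _ : Fin p => gaussianReal 0 1).map (fun a => dotp a w) =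
      (gaussianReal 0 1).map (fun x => √(∑ i, w i ^ 2) * x) := by
  have hm : Measurable fun a : Fin p → ℝ => dotp a w := by unfold dotp; fun_prop
  have : IsProbabilityMeasure ((Measure.pi fun _ : Fin p => gaussianReal 0 1).map
    (fun a => dotp a w)) := Measure.isProbabilityMeasure_map hm.aemeasurable
  rw [gaussianReal_map_const_mul]
  apply Measure.ext_of_charFun
  ext t
  rw [charFun_gaussianReal, charFun_apply_real, integral_map hm.aemeasurable (by fun_prop)]
  have : ∀ a : Fin p → ℝ, Complex.exp (t * (dotp a w : ℝ) * Complex.I) =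
      ∏ i, Complex.exp ((t * w i : ℝ) * (a i : ℝ) * Complex.I) := by
    intro a
    rw [← Complex.exp_sum, dotp]
    congr 1
    push_cast
    rw [Finset.mul_sum, Finset.sum_mul]
    exact Finset.sum_congr rfl fun i _ => by ring
  simp_rw [this]
  rw [integral_fintype_prod_eq_prod
    (f := fun i (x : ℝ) => Complex.exp ((t * w i : ℝ) * (x : ℝ) * Complex.I))]
  simp_rw [← charFun_apply_real, charFun_gaussianReal]
  rw [← Complex.exp_sum]
  congr 1
  have h : 0 ≤ ∑ i, w i ^ 2 := Finset.sum_nonneg fun i _ => sq_nonneg _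
  have h' : ((√(∑ i, w i ^ 2) : ℝ) : ℂ) ^ 2 = ∑ i, (w i : ℂ) ^ 2 := by
    rw [← Complex.ofReal_pow, Real.sq_sqrt h]; push_cast; rfl
  simp [h']
  rw [Finset.sum_mul, Finset.sum_div]
  exact Finset.sum_congr rfl fun i _ => by ring

lemma dotp_sq_aux {p : ℕ} (w : Fin p → ℝ) (l : ℝ) (hl : |l * ∑ i, w i ^ 2| ≤ 1 / 4) :
    Integrable (fun a : Fin p → ℝ => Real.exp (l * (dotp a w ^ 2 - ∑ i, w i ^ 2)))
      (Measure.pi fun _ : Fin p => gaussianReal 0 1) ∧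
    ∫ a, Real.exp (l * (dotp a w ^ 2 - ∑ i, w i ^ 2))
      ∂(Measure.pi fun _ : Fin p => gaussianReal 0 1) ≤
      Real.exp (2 * (l * ∑ i, w i ^ 2) ^ 2) := by
  have hm : Measurable fun a : Fin p → ℝ => dotp a w := by unfold dotp; fun_prop
  have h : 0 ≤ ∑ i, w i ^ 2 := Finset.sum_nonneg fun i _ => sq_nonneg _
  set s := ∑ i, w i ^ 2 with hs
  obtain ⟨g1, g2⟩ := gauss_sq_aux _ hl
  have e0 : ∀ x : ℝ, Real.exp (l * ((√s * x) ^ 2 - s)) =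
      Real.exp (-(l * s)) * Real.exp (l * s * x ^ 2) := by
    intro x
    rw [← Real.exp_add, mul_pow, Real.sq_sqrt h]; congr 1; ring
  constructor
  · have : Integrable (fun y : ℝ => Real.exp (l * (y ^ 2 - s)))
        ((Measure.pi fun _ : Fin p => gaussianReal 0 1).map (fun a => dotp a w)) := by
      rw [dotp_law, integrable_map_measure (by fun_prop) (by fun_prop)]
      simp only [Function.comp_def, ← hs, e0]
      exact g1.const_mul _
    exact (integrable_map_measure (by fun_prop) hm.aemeasurable).1 this
  · rw [← integral_map (φ := fun a => dotp a w) (f := fun y : ℝ => Real.exp (l * (y ^ 2 - s)))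
      hm.aemeasurable (by fun_prop), dotp_law, integral_map (by fun_prop) (by fun_prop)]
    simp only [← hs, e0]
    rw [integral_const_mul]
    refine (mul_le_mul_of_nonneg_left g2 (Real.exp_pos _).le).trans ?_
    rw [← Real.exp_add]
    apply Real.exp_le_exp.2
    linarith

lemma prod_aux {p : ℕ} (w z : Fin p → ℝ) (hw : ∑ i, w i ^ 2 = 1) (hz : ∑ i, z i ^ 2 = 1)
    (t : ℝ) (ht : |t| ≤ 1 / 8) :
    Integrable (fun a : Fin p → ℝ => Real.exp (t * (dotp a w * dotp a z - dotp w z)))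
      (Measure.pi fun _ : Fin p => gaussianReal 0 1) ∧
    ∫ a, Real.exp (t * (dotp a w * dotp a z - dotp w z))
      ∂(Measure.pi fun _ : Fin p => gaussianReal 0 1) ≤ Real.exp (8 * t ^ 2) := by
  have hs : ∑ i, (w + z) i ^ 2 = 2 + 2 * dotp w z := by
    have : ∀ i, (w + z) i ^ 2 = w i ^ 2 + z i ^ 2 + 2 * (w i * z i) := by
      intro i; simp only [Pi.add_apply]; ring
    simp_rw [this, Finset.sum_add_distrib, ← Finset.mul_sum, hw, hz, dotp]; ring
  have hr : ∑ i, (w - z) i ^ 2 = 2 - 2 * dotp w z := by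
    have : ∀ i, (w - z) i ^ 2 = w i ^ 2 + z i ^ 2 - 2 * (w i * z i) := by
      intro i; simp only [Pi.sub_apply]; ring
    simp_rw [this, Finset.sum_sub_distrib, Finset.sum_add_distrib, ← Finset.mul_sum, hw, hz, dotp]
    ring
  have hs0 : 0 ≤ ∑ i, (w + z) i ^ 2 := Finset.sum_nonneg fun i _ => sq_nonneg _
  have hr0 : 0 ≤ ∑ i, (w - z) i ^ 2 := Finset.sum_nonneg fun i _ => sq_nonneg _
  have dp : ∀ a, dotp a (w + z) = dotp a w + dotp a z := by
    intro a; simp [dotp, mul_add, Finset.sum_add_distrib]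
  have dm : ∀ a, dotp a (w - z) = dotp a w - dotp a z := by
    intro a; simp [dotp, mul_sub, Finset.sum_sub_distrib]
  have bd : ∀ l x : ℝ, |l| ≤ 1 / 16 → 0 ≤ x → x ≤ 4 → |l * x| ≤ 1 / 4 := by
    intro l x hl h0 h4
    rw [abs_mul, abs_of_nonneg h0]
    nlinarith [abs_nonneg l]
  have ht2 : |t / 2| ≤ 1 / 16 := by rw [abs_div, abs_two]; linarith
  obtain ⟨a1, a2⟩ := dotp_sq_aux (w + z) (t / 2) (bd _ _ ht2 hs0 (by linarith))
  obtain ⟨b1, b2⟩ := dotp_sq_aux (w - z) (-(t / 2))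
    (bd _ _ (by rwa [abs_neg]) hr0 (by linarith))
  have sqb : ∀ x : ℝ, 0 ≤ x → x ≤ 4 → Real.exp (2 * (t / 2 * x) ^ 2) ≤ Real.exp (8 * t ^ 2) := by
    intro x h0 h4
    apply Real.exp_le_exp.2
    nlinarith [mul_nonneg (sq_nonneg t) (by nlinarith : 0 ≤ 16 - x ^ 2)]
  have a3 := a2.trans (sqb _ hs0 (by linarith))
  have b3 := b2.trans ((by rw [neg_mul, neg_sq] :
    Real.exp (2 * (-(t / 2) * ∑ i, (w - z) i ^ 2) ^ 2) =
    Real.exp (2 * ((t / 2) * ∑ i, (w - z) i ^ 2) ^ 2)).trans_le (sqb _ hr0 (by linarith)))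
  have pw : ∀ a : Fin p → ℝ, Real.exp (t * (dotp a w * dotp a z - dotp w z)) ≤
      (1 / 2) * (Real.exp (t / 2 * (dotp a (w + z) ^ 2 - ∑ i, (w + z) i ^ 2)) +
      Real.exp (-(t / 2) * (dotp a (w - z) ^ 2 - ∑ i, (w - z) i ^ 2))) := by
    intro a
    rw [hs, hr, dp, dm]
    set A := t / 2 * ((dotp a w + dotp a z) ^ 2 - (2 + 2 * dotp w z)) with hA
    set B := -(t / 2) * ((dotp a w - dotp a z) ^ 2 - (2 - 2 * dotp w z)) with hB
    have e : t * (dotp a w * dotp a z - dotp w z) = A / 2 + B / 2 := by rw [hA, hB]; ring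
    have eA : Real.exp A = Real.exp (A / 2) ^ 2 := by rw [← Real.exp_nat_mul]; congr 1; push_cast; ring
    have eB : Real.exp B = Real.exp (B / 2) ^ 2 := by rw [← Real.exp_nat_mul]; congr 1; push_cast; ring
    rw [e, Real.exp_add, eA, eB]
    nlinarith [sq_nonneg (Real.exp (A / 2) - Real.exp (B / 2))]
  have hI := (a1.add b1).const_mul (1 / 2)
  have hInt : Integrable (fun a : Fin p → ℝ => Real.exp (t * (dotp a w * dotp a z - dotp w z)))
      (Measure.pi fun _ : Fin p => gaussianReal 0 1) := by
    refine hI.mono' ?_ (ae_of_all _ fun a => ?_)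
    · unfold dotp; fun_prop
    · rw [Real.norm_of_nonneg (Real.exp_pos _).le]; exact pw a
  refine ⟨hInt, (integral_mono hInt hI pw).trans ?_⟩
  have : ∫ a, (1 / 2 : ℝ) * ((fun a => Real.exp (t / 2 * (dotp a (w + z) ^ 2 - ∑ i, (w + z) i ^ 2))) +
      fun a => Real.exp (-(t / 2) * (dotp a (w - z) ^ 2 - ∑ i, (w - z) i ^ 2))) a
      ∂(Measure.pi fun _ : Fin p => gaussianReal 0 1) = _ :=
    (integral_const_mul _ _).trans (congrArg _ (integral_add a1 b1))
  exact this.trans_le (by linarith)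

lemma tail_aux {n p : ℕ} (w z : Fin p → ℝ) (hw : ∑ i, w i ^ 2 = 1)
    (hz : ∑ i, z i ^ 2 = 1) (ε : ℝ) (h0 : 0 < ε) (h1 : ε < 1) (σ : ℝ) (hσ : |σ| = 1) :
    (Measure.pi fun _ : Fin n => Measure.pi fun _ : Fin p => gaussianReal 0 1).real
      {a | n * ε ≤ (∑ i : Fin n, fun a : Fin n → Fin p → ℝ =>
        σ * (dotp (a i) w * dotp (a i) z - dotp w z)) a} ≤ Real.exp (-(1 / 32) * n * ε ^ 2) := by
  set Y : (Fin p → ℝ) → ℝ := fun b => σ * (dotp b w * dotp b z - dotp w z) with hY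
  have hYm : Measurable Y := by simp only [hY]; unfold dotp; fun_prop
  set P := Measure.pi fun _ : Fin p => gaussianReal 0 1 with hP
  have ind : iIndepFun (fun (i : Fin n) (a : Fin n → Fin p → ℝ) => Y (a i))
      (Measure.pi fun _ : Fin n => P) := iIndepFun_pi fun i => hYm.aemeasurable
  have hσ2 : σ ^ 2 = 1 := by rw [← sq_abs, hσ, one_pow]
  obtain ⟨i1, i2⟩ := prod_aux w z hw hz (ε / 16 * σ)
    (by rw [abs_mul, hσ, abs_of_pos (by positivity)]; linarith)
  have hI : Integrable (fun b => Real.exp (ε / 16 * Y b)) P := by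
    simpa only [hY, mul_assoc] using i1
  have hM : ∫ b, Real.exp (ε / 16 * Y b) ∂P ≤ Real.exp (8 * (ε / 16) ^ 2) := by
    rw [mul_pow, hσ2, mul_one] at i2
    simpa only [hY, mul_assoc] using i2
  have mp : ∀ i : Fin n, MeasurePreserving (Function.eval i)
    (Measure.pi fun _ : Fin n => P) P := fun i => measurePreserving_eval _ i
  have hmeas : ∀ i : Fin n, Measurable fun a : Fin n → Fin p → ℝ => Y (a i) :=
    fun i => hYm.comp (measurable_pi_apply i)
  have hI' : ∀ i : Fin n, Integrable (fun a : Fin n → Fin p → ℝ => Real.exp (ε / 16 * Y (a i)))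
      (Measure.pi fun _ : Fin n => P) := fun i => (mp i).integrable_comp_of_integrable hI
  have hS := ind.integrable_exp_mul_sum hmeas (s := Finset.univ) fun i _ => hI' i
  refine (measure_ge_le_exp_mul_mgf (n * ε) (by positivity : 0 ≤ ε / 16) hS).trans ?_
  rw [ind.mgf_sum hmeas]
  have hM' : ∀ i : Fin n, mgf (fun a : Fin n → Fin p → ℝ => Y (a i))
      (Measure.pi fun _ : Fin n => P) (ε / 16) ≤ Real.exp (8 * (ε / 16) ^ 2) := by
    intro i
    refine le_of_eq_of_le ?_ hM
    have := integral_map (μ := Measure.pi fun _ : Fin n => P) (φ := Function.eval i)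
      (f := fun b => Real.exp (ε / 16 * Y b)) (measurable_pi_apply i).aemeasurable
      (by rw [(mp i).map_eq]; exact hI.aestronglyMeasurable)
    rw [(mp i).map_eq] at this
    exact this.symm
  refine (mul_le_mul_of_nonneg_left (Finset.prod_le_prod (fun i _ => mgf_nonneg)
    fun i _ => hM' i) (Real.exp_pos _).le).trans ?_
  rw [Finset.prod_const, Finset.card_univ, Fintype.card_fin, ← Real.exp_nat_mul, ← Real.exp_add]
  apply Real.exp_le_exp.2
  apply le_of_eq
  ring

lemma tail2_aux {n p : ℕ} (w z : Fin p → ℝ) (hw : ∑ i, w i ^ 2 = 1)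
    (hz : ∑ i, z i ^ 2 = 1) (ε : ℝ) (h0 : 0 < ε) (h1 : ε < 1) :
    ENNReal.ofReal (1 - 2 * Real.exp (-(1 / 32) * n * ε ^ 2)) ≤
    (Measure.pi fun _ : Fin n => Measure.pi fun _ : Fin p => gaussianReal 0 1)
      {a | |∑ i : Fin n, dotp (a i) w * dotp (a i) z - n * dotp w z| ≤ n * ε} := by
  have t1 := tail_aux (n := n) w z hw hz ε h0 h1 1 (by simp)
  have t2 := tail_aux (n := n) w z hw hz ε h0 h1 (-1) (by simp)
  set Q := Measure.pi fun _ : Fin n => Measure.pi fun _ : Fin p => gaussianReal 0 1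
  have hcov : Set.univ ⊆ {a : Fin n → Fin p → ℝ |
      |∑ i : Fin n, dotp (a i) w * dotp (a i) z - n * dotp w z| ≤ n * ε} ∪
      ({a | n * ε ≤ (∑ i : Fin n, fun a : Fin n → Fin p → ℝ =>
        1 * (dotp (a i) w * dotp (a i) z - dotp w z)) a} ∪
      {a | n * ε ≤ (∑ i : Fin n, fun a : Fin n → Fin p → ℝ =>
        (-1) * (dotp (a i) w * dotp (a i) z - dotp w z)) a}) := by
    intro a _
    simp only [Set.mem_union, Set.mem_ofPred_eq, Finset.sum_apply, ← Finset.mul_sum,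
      Finset.sum_sub_distrib, Finset.sum_const, Finset.card_univ, Fintype.card_fin, nsmul_eq_mul]
    by_contra! hh
    obtain ⟨q1, q2, q3⟩ := hh
    have := abs_le.2 ⟨by linarith, by linarith⟩ |>.trans_lt q1 |>.false
    exact this
  rw [ENNReal.ofReal_le_iff_le_toReal (measure_ne_top _ _)]
  change _ ≤ Q.real _
  have := (measureReal_mono hcov (measure_ne_top Q _)).trans
    ((measureReal_union_le _ _).trans (add_le_add le_rfl (measureReal_union_le _ _)))
  rw [probReal_univ] at this
  linarith

lemma dotp_expand {n p : ℕ} (a : Fin n → Fin p → ℝ) (x₁ x₂ : Fin p → ℝ) (k : ℝ) :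
    dotp (x₁ - k • (((Matrix.of a).transpose * Matrix.of a).mulVec x₁)) x₂ =
      dotp x₁ x₂ - k * ∑ i, dotp (a i) x₁ * dotp (a i) x₂ := by
  have hd : ∀ (m : ℕ) (u v : Fin m → ℝ), dotp u v = u ⬝ᵥ v := fun _ _ _ => rfl
  simp only [hd]
  rw [sub_dotProduct, smul_dotProduct, smul_eq_mul, ← Matrix.mulVec_mulVec,
    Matrix.mulVec_transpose, ← Matrix.dotProduct_mulVec]
  rfl

/-- Lemma 4: there is an absolute constant `c > 0` such that for a matrix `A` with i.i.d.
`N(0, I_p)` rows, fixed `x₁, x₂ ∈ ℝ^p`, `ν > 0` and `ε ∈ (0,1)`, with probability at least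
`1 − 2e^{−cnε²}` one has `|⟨(I_p − (ν/n)AᵀA)x₁, x₂⟩| ≤ μ₁‖x₁‖₂‖x₂‖₂`, where
`μ₁ = max{1 − ν(1−ε), ν(1+ε) − 1}`. -/
theorem lemma4_gaussian :
    ∃ c : ℝ, 0 < c ∧
      ∀ (n p : ℕ), 0 < n → ∀ (x₁ x₂ : Fin p → ℝ) (ν ε : ℝ), 0 < ν →
        ε ∈ Set.Ioo (0 : ℝ) 1 →
        ENNReal.ofReal (1 - 2 * Real.exp (-c * n * ε ^ 2)) ≤
          (Measure.pi fun _ : Fin n => Measure.pi fun _ : Fin p => gaussianReal 0 1)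
            {a : Fin n → Fin p → ℝ |
              |dotp (x₁ - (ν / (n : ℝ)) •
                  (((Matrix.of a).transpose * Matrix.of a).mulVec x₁)) x₂| ≤
                max (1 - ν * (1 - ε)) (ν * (1 + ε) - 1) * l2norm x₁ * l2norm x₂} := by
  refine ⟨1 / 32, by norm_num, ?_⟩
  intro n p hn x₁ x₂ ν ε hν hε
  have hn' : (0 : ℝ) < n := by exact_mod_cast hn
  have hnn : ∀ x : Fin p → ℝ, 0 ≤ ∑ i, x i ^ 2 :=
    fun x => Finset.sum_nonneg fun i _ => sq_nonneg _
  have l2z : ∀ x : Fin p → ℝ, l2norm x = 0 → x = 0 := by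
    intro x hx
    rw [l2norm, Real.sqrt_eq_zero (hnn x), Finset.sum_eq_zero_iff_of_nonneg
      fun i _ => sq_nonneg _] at hx
    funext i
    simpa using hx i (Finset.mem_univ i)
  have hd0 : ∀ u : Fin p → ℝ, dotp u 0 = 0 := fun u => by simp [dotp]
  have hd0' : ∀ u : Fin p → ℝ, dotp 0 u = 0 := fun u => by simp [dotp]
  have h20 : l2norm (0 : Fin p → ℝ) = 0 := by simp [l2norm]
  have triv : ENNReal.ofReal (1 - 2 * Real.exp (-(1 / 32) * n * ε ^ 2)) ≤ 1 := by
    rw [ENNReal.ofReal_le_one]; linarith [Real.exp_pos (-(1 / 32) * n * ε ^ 2)]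
  simp only [dotp_expand]
  by_cases hx1 : l2norm x₁ = 0
  · rw [l2z _ hx1]; simpa [hd0, hd0', h20] using triv
  by_cases hx2 : l2norm x₂ = 0
  · rw [l2z _ hx2]; simpa [hd0, hd0', h20] using triv
  have hp1 : 0 < l2norm x₁ := lt_of_le_of_ne (Real.sqrt_nonneg _) (Ne.symm hx1)
  have hp2 : 0 < l2norm x₂ := lt_of_le_of_ne (Real.sqrt_nonneg _) (Ne.symm hx2)
  have unit : ∀ x : Fin p → ℝ, 0 < l2norm x → ∑ i, ((l2norm x)⁻¹ • x) i ^ 2 = 1 := by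
    intro x hx
    have : l2norm x ^ 2 = ∑ i, x i ^ 2 := Real.sq_sqrt (hnn x)
    simp only [Pi.smul_apply, smul_eq_mul, mul_pow]
    rw [← Finset.mul_sum, ← this, ← mul_pow, inv_mul_cancel₀ hx.ne', one_pow]
  have hsmul : ∀ (u x : Fin p → ℝ) (k : ℝ), dotp u (k • x) = k * dotp u x := by
    intro u x k
    simp only [dotp, Pi.smul_apply, smul_eq_mul, Finset.mul_sum]
    exact Finset.sum_congr rfl fun i _ => by ring
  set w := (l2norm x₁)⁻¹ • x₁ with hw
  set z := (l2norm x₂)⁻¹ • x₂ with hz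
  have e1 : x₁ = l2norm x₁ • w := by rw [hw, smul_smul, mul_inv_cancel₀ hx1, one_smul]
  have e2 : x₂ = l2norm x₂ • z := by rw [hz, smul_smul, mul_inv_cancel₀ hx2, one_smul]
  have hcomm : ∀ u v : Fin p → ℝ, dotp u v = dotp v u := by
    intro u v; simp [dotp, mul_comm]
  have uw := unit x₁ hp1
  have uz := unit x₂ hp2
  have d1 : ∀ u, dotp u x₁ = l2norm x₁ * dotp u w := fun u => by rw [← hsmul, ← e1]
  have d2 : ∀ u, dotp u x₂ = l2norm x₂ * dotp u z := fun u => by rw [← hsmul, ← e2]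
  have d12 : dotp x₁ x₂ = l2norm x₁ * l2norm x₂ * dotp w z := by
    rw [d2, hcomm, d1, hcomm]; ring
  have hρ : |dotp w z| ≤ 1 := by
    have h1 : dotp w z ^ 2 ≤ 1 := by
      have := Finset.sum_mul_sq_le_sq_mul_sq Finset.univ w z
      rw [uw, uz] at this; simpa [dotp] using this
    exact (sq_le_one_iff_abs_le_one _).1 h1
  refine (tail2_aux w z uw uz ε hε.1 hε.2).trans (measure_mono ?_)
  intro a ha
  simp only [Set.mem_ofPred_eq] at ha ⊢
  set S := ∑ i : Fin n, dotp (a i) w * dotp (a i) z with hS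
  have hsum : ∑ i, dotp (a i) x₁ * dotp (a i) x₂ = l2norm x₁ * l2norm x₂ * S := by
    rw [hS, Finset.mul_sum]
    exact Finset.sum_congr rfl fun i _ => by rw [d1, d2]; ring
  rw [hsum, d12]
  have e3 : l2norm x₁ * l2norm x₂ * dotp w z - ν / n * (l2norm x₁ * l2norm x₂ * S) =
      l2norm x₁ * l2norm x₂ * ((1 - ν) * dotp w z - ν / n * (S - n * dotp w z)) := by
    field_simp
    ring
  rw [e3, abs_mul, abs_of_pos (mul_pos hp1 hp2)]
  rw [mul_assoc (max _ _), mul_comm (max _ _)]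
  apply mul_le_mul_of_nonneg_left _ (mul_pos hp1 hp2).le
  have f1 : |(1 - ν) * dotp w z| ≤ |1 - ν| := by
    rw [abs_mul]; exact mul_le_of_le_one_right (abs_nonneg _) hρ
  have f2 : |ν / n * (S - n * dotp w z)| ≤ ν * ε := by
    rw [abs_mul, abs_of_pos (div_pos hν hn')]
    calc ν / n * |S - n * dotp w z| ≤ ν / n * (n * ε) :=
          mul_le_mul_of_nonneg_left ha (div_pos hν hn').le
      _ = ν * ε := by field_simp
  refine (abs_sub _ _).trans ((add_le_add f1 f2).trans ?_)
  rcases abs_cases (1 - ν) with ⟨h, _⟩ | ⟨h, _⟩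
  · exact le_max_of_le_left (by rw [h]; linarith)
  · exact le_max_of_le_right (by rw [h]; linarith)
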